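/- arXiv:1802.07394 — 2 statements merged into one kernel-verified Lean document; each statement's English description precedes it below -/
import Mathlib

section
/- Let n, k ≥ 1, let r = ⌈n/k⌉ ≥ 2, and let P₁, …, P_r be orthogonal projections in M_n(ℂ), each of rank at most k, satisfying P₁ + ⋯ + P_r = I_n. Then every operator system properly contained in span_ℂ(P₁, …, P_r) has a quantum (k+1)-anticlique. -/
open Matrix

/-- An operator system: a subspace of matrices containing the identity and
closed under conjugate transpose. -/
def IsOperatorSystem {ι : Type*} [Fintype ι] [DecidableEq ι]
    (V : Submodule ℂ (Matrix ι ι ℂ)) : Prop :=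
  (1 : Matrix ι ι ℂ) ∈ V ∧ ∀ A ∈ V, Aᴴ ∈ V

/-- An orthogonal projection: `P = P² = P*`. -/
def IsOrthogonalProjection {ι : Type*} [Fintype ι] [DecidableEq ι]
    (P : Matrix ι ι ℂ) : Prop :=
  P * P = P ∧ Pᴴ = P

/-- The compression `PVP = {PAP : A ∈ V}`. -/
noncomputable def compress {ι : Type*} [Fintype ι] [DecidableEq ι]
    (P : Matrix ι ι ℂ) (V : Submodule ℂ (Matrix ι ι ℂ)) :
    Submodule ℂ (Matrix ι ι ℂ) :=
  V.map ((LinearMap.mulLeft ℂ P).comp (LinearMap.mulRight ℂ P))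

/-- `V` has a quantum `k`-anticlique: a rank-`k` orthogonal projection `P`
with `dim (PVP) = 1`. -/
def HasQuantumAnticlique {ι : Type*} [Fintype ι] [DecidableEq ι]
    (V : Submodule ℂ (Matrix ι ι ℂ)) (k : ℕ) : Prop :=
  ∃ P : Matrix ι ι ℂ, IsOrthogonalProjection P ∧ P.rank = k ∧
    Module.finrank ℂ (compress P V) = 1

/-- `V` has a quantum `k`-clique: a rank-`k` orthogonal projection `P`
with `dim (PVP) = k²`. -/
def HasQuantumClique {ι : Type*} [Fintype ι] [DecidableEq ι]
    (V : Submodule ℂ (Matrix ι ι ℂ)) (k : ℕ) : Prop :=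
  ∃ P : Matrix ι ι ℂ, IsOrthogonalProjection P ∧ P.rank = k ∧
    Module.finrank ℂ (compress P V) = k ^ 2

theorem exists_partial_isometry {n β : Type*} [Fintype n] [DecidableEq n] [Fintype β]
    [DecidableEq β] (P : Matrix n n ℂ) (hP : P * P = P) (S : Finset β) (hS : S.card ≤ P.rank) :
    ∃ U : Matrix n β ℂ, Uᴴ * U = diagonal (fun b => if b ∈ S then 1 else 0) ∧ P * U = U := by
  classical
  set R := LinearMap.range (toEuclideanLin P) with hR
  have hfr : Module.finrank ℂ R = P.rank := by
    rw [P.rank_eq_finrank_range_toLin (EuclideanSpace.basisFun n ℂ).toBasis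
      (EuclideanSpace.basisFun n ℂ).toBasis]
    rfl
  let b := stdOrthonormalBasis ℂ R
  obtain ⟨e⟩ : Nonempty (S ↪ Fin (Module.finrank ℂ R)) := by
    apply Function.Embedding.nonempty_of_card_le
    simpa [hfr] using hS
  let u : β → EuclideanSpace ℂ n := fun s =>
    if h : s ∈ S then (b (e ⟨s, h⟩) : EuclideanSpace ℂ n) else 0
  refine ⟨Matrix.of fun i s => u s i, ?_, ?_⟩
  · ext s t
    have : ((of fun i s => u s i)ᴴ * (of fun i s => u s i)) s t = inner ℂ (u s) (u t) := by
      simp [Matrix.mul_apply, PiLp.inner_apply, mul_comm]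
    rw [this, diagonal_apply]
    simp only [u]
    have hb := orthonormal_iff_ite.mp b.orthonormal
    by_cases hs : s ∈ S <;> by_cases ht : t ∈ S <;> simp [hs, ht]
    · rw [← Submodule.coe_inner, hb]
      simp [e.injective.eq_iff]
    · rintro rfl; exact absurd hs ht
  · ext i s
    have hu : u s ∈ R := by
      simp only [u]; split_ifs
      · exact Subtype.property _
      · exact zero_mem _
    obtain ⟨v, hv⟩ := hu
    have h2 : toEuclideanLin P (u s) = u s := by
      rw [← hv]
      ext j
      simp [toLpLin_apply, Matrix.mulVec_mulVec, hP]
    have := congrArg (fun w : EuclideanSpace ℂ n => w i) h2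
    simpa [toLpLin_apply, Matrix.mulVec, dotProduct, Matrix.mul_apply] using this

open scoped MatrixOrder ComplexOrder in
theorem mul_eq_zero_of_sum_eq_one {n ι : Type*} [Fintype n] [DecidableEq n] [Fintype ι]
    [DecidableEq ι] (P : ι → Matrix n n ℂ) (hP : ∀ i, IsOrthogonalProjection (P i)) (hsum : ∑ i, P i = 1)
    {i j : ι} (hij : i ≠ j) : P i * P j = 0 := by
  have h1 : ∑ l ∈ Finset.univ.erase j, (P l * P j)ᴴ * (P l * P j) = 0 := by
    have h2 : ∑ l, (P l * P j)ᴴ * (P l * P j) = P j := by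
      calc _ = ∑ l, P j * P l * P j := by
            refine Finset.sum_congr rfl fun l _ => ?_
            rw [conjTranspose_mul, (hP l).2, (hP j).2, ← Matrix.mul_assoc,
              Matrix.mul_assoc (P j), (hP l).1]
        _ = P j := by rw [← Finset.sum_mul, ← Finset.mul_sum, hsum, Matrix.mul_one, (hP j).1]
    rw [← Finset.add_sum_erase _ _ (Finset.mem_univ j), (hP j).1, (hP j).2, (hP j).1] at h2
    simpa using h2
  have h3 := (Finset.sum_eq_zero_iff_of_nonneg
    (fun l _ => (posSemidef_conjTranspose_mul_self (P l * P j)).nonneg)).mp h1 i (by simp [hij])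
  exact conjTranspose_mul_self_eq_zero.mp h3

theorem exists_real_annihilator {ι : Type*} [Fintype ι] [DecidableEq ι] (W : Submodule ℂ (ι → ℂ))
    (hW : W ≠ ⊤) (hstar : ∀ w ∈ W, star w ∈ W) :
    ∃ c : ι → ℝ, c ≠ 0 ∧ ∀ w ∈ W, ∑ i, (c i : ℂ) * w i = 0 := by
  obtain ⟨f, hf, hWf⟩ := Submodule.exists_le_ker_of_lt_top W (lt_top_iff_ne_top.mpr hW)
  let g : ι → ℂ := fun i => f (Pi.single i 1)
  have hg : ∀ w, f w = ∑ i, g i * w i := fun w => by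
    conv_lhs => rw [← Finset.univ_sum_single w, map_sum]
    refine Finset.sum_congr rfl fun i _ => ?_
    rw [mul_comm, ← smul_eq_mul, ← map_smul, ← Pi.single_smul, smul_eq_mul, mul_one]
  have hA : ∀ w ∈ W, ∑ i, g i * w i = 0 := fun w hw => by rw [← hg]; exact hWf hw
  have hB : ∀ w ∈ W, ∑ i, star (g i) * w i = 0 := fun w hw => by
    have := congrArg star (hA _ (hstar w hw))
    simpa using this
  by_cases hre : (fun i => (g i).re) = 0
  · refine ⟨fun i => (g i).im, fun him => hf ?_, fun w hw => ?_⟩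
    · ext i
      simpa [Complex.ext_iff] using ⟨congrFun hre i, congrFun him i⟩
    · have h : ∑ i, ((g i).im : ℂ) * w i =
          (∑ i, g i * w i - ∑ i, star (g i) * w i) / (2 * Complex.I) := by
        rw [← Finset.sum_sub_distrib, Finset.sum_div]
        refine Finset.sum_congr rfl fun i _ => ?_
        rw [Complex.im_eq_sub_conj, starRingEnd_apply]; ring
      rw [h, hA w hw, hB w hw]; simp
  · refine ⟨fun i => (g i).re, hre, fun w hw => ?_⟩
    have h : ∑ i, ((g i).re : ℂ) * w i = (∑ i, g i * w i + ∑ i, star (g i) * w i) / 2 := by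
      rw [← Finset.sum_add_distrib, Finset.sum_div]
      refine Finset.sum_congr rfl fun i _ => ?_
      rw [Complex.re_eq_add_conj, starRingEnd_apply]; ring
    rw [h, hA w hw, hB w hw]; simp

theorem exists_normalized_real_annihilator {ι : Type*} [Fintype ι] [DecidableEq ι]
    (W : Submodule ℂ (ι → ℂ))
    (hW : W ≠ ⊤) (hone : 1 ∈ W) (hstar : ∀ w ∈ W, star w ∈ W) :
    ∃ c : ι → ℝ, (∃ i, 0 < c i) ∧ ∑ i, |c i| = 2 ∧ ∀ w ∈ W, ∑ i, (c i : ℂ) * w i = 0 := by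
  obtain ⟨c, hc, hcW⟩ := exists_real_annihilator W hW hstar
  have h0 : ∑ i, c i = 0 := by
    have := hcW 1 hone
    simp only [Pi.one_apply, mul_one] at this
    exact_mod_cast this
  obtain ⟨i, hi⟩ : ∃ i, 0 < c i := by
    by_contra! h
    exact hc (funext fun i =>
      (Finset.sum_eq_zero_iff_of_nonpos fun i _ => h i).mp h0 i (Finset.mem_univ i))
  have hpos : 0 < ∑ i, |c i| :=
    Finset.sum_pos' (fun i _ => abs_nonneg _) ⟨i, Finset.mem_univ i, abs_pos.mpr hi.ne'⟩
  refine ⟨fun j => 2 / (∑ i, |c i|) * c j, ⟨i, by positivity⟩, ?_, fun w hw => ?_⟩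
  · simp_rw [abs_mul, ← Finset.mul_sum]
    rw [abs_of_pos (by positivity)]
    field_simp
  · push_cast
    simp_rw [mul_assoc, ← Finset.mul_sum]
    rw [hcW w hw, mul_zero]

theorem card_le_sum_rank {n ι : Type*} [Fintype n] [DecidableEq n] [Fintype ι]
    (P : ι → Matrix n n ℂ) (hsum : ∑ i, P i = 1) : Fintype.card n ≤ ∑ i, (P i).rank := by
  classical
  have h : ∀ s : Finset ι, (∑ i ∈ s, P i).rank ≤ ∑ i ∈ s, (P i).rank := fun s => by
    induction s using Finset.induction_on with
    | empty => simp
    | insert a s ha ih =>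
      rw [Finset.sum_insert ha, Finset.sum_insert ha]
      refine le_trans ?_ (Nat.add_le_add_left ih _)
      have h := LinearMap.rank_add_le (P a).mulVecLin (∑ i ∈ s, P i).mulVecLin
      rw [← Matrix.mulVecLin_add] at h
      unfold LinearMap.rank at h
      simp only [← Module.finrank_eq_rank] at h
      exact_mod_cast h
  simpa [hsum] using h Finset.univ

theorem lt_add_of_le_sum {n k r : ℕ} (hk : 1 ≤ k) (hr : r = ⌈(n : ℚ) / (k : ℚ)⌉₊) (hr2 : 2 ≤ r)
    (d : Fin r → ℕ) (hd : ∀ i, d i ≤ k) (hsum : n ≤ ∑ i, d i) {i j : Fin r} (hij : i ≠ j) :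
    k < d i + d j := by
  have h1 : (r - 1) * k < n := by
    have : r - 1 < ⌈(n : ℚ) / (k : ℚ)⌉₊ := by omega
    rw [Nat.lt_ceil, lt_div_iff₀ (by positivity)] at this
    exact_mod_cast this
  have h2 : ∑ l ∈ (Finset.univ.erase i).erase j, d l ≤ (r - 2) * k := by
    refine (Finset.sum_le_card_nsmul _ _ k fun l _ => hd l).trans (le_of_eq ?_)
    rw [Finset.card_erase_of_mem (by simp [hij.symm]), Finset.card_erase_of_mem (by simp)]
    simp [Nat.sub_sub]
  rw [← Finset.add_sum_erase _ _ (Finset.mem_univ i),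
    ← Finset.add_sum_erase _ _ (show j ∈ Finset.univ.erase i by simp [hij.symm])] at hsum
  obtain ⟨s, rfl⟩ := Nat.exists_eq_add_of_le hr2
  have e1 : 2 + s - 1 = s + 1 := by omega
  have e2 : 2 + s - 2 = s := by omega
  rw [e1, add_mul] at h1
  rw [e2] at h2
  omega

open scoped ComplexOrder in
theorem hasQuantumAnticlique_of_isometry {n : Type*} [Fintype n] [DecidableEq n] {m : ℕ}
    (hm : 1 ≤ m) {V : Submodule ℂ (Matrix n n ℂ)} (h1 : (1 : Matrix n n ℂ) ∈ V)
    (X : Matrix n (Fin m) ℂ) (hX : Xᴴ * X = 1)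
    (hV : ∀ A ∈ V, ∃ a : ℂ, Xᴴ * A * X = a • 1) :
    HasQuantumAnticlique V m := by
  have hrank : (X * Xᴴ).rank = m := by
    rw [rank_self_mul_conjTranspose, ← rank_conjTranspose_mul_self, hX, rank_one, Fintype.card_fin]
  have hidem : X * Xᴴ * (X * Xᴴ) = X * Xᴴ := by
    rw [Matrix.mul_assoc, ← Matrix.mul_assoc Xᴴ, hX, Matrix.one_mul]
  refine ⟨X * Xᴴ, ⟨hidem, by simp⟩, hrank, ?_⟩
  have hne : X * Xᴴ ≠ 0 := fun h => by
    rw [h, rank_zero] at hrank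
    omega
  have hspan : compress (X * Xᴴ) V = Submodule.span ℂ {X * Xᴴ} := by
    apply le_antisymm
    · rintro _ ⟨A, hA, rfl⟩
      obtain ⟨a, ha⟩ := hV A hA
      refine Submodule.mem_span_singleton.mpr ⟨a, ?_⟩
      calc a • (X * Xᴴ) = X * (a • (1 : Matrix (Fin m) (Fin m) ℂ)) * Xᴴ := by simp
        _ = X * Xᴴ * (A * (X * Xᴴ)) := by rw [← ha]; simp only [Matrix.mul_assoc]
    · rw [Submodule.span_singleton_le_iff_mem]
      exact ⟨1, h1, by simp [hidem]⟩
  rw [hspan, finrank_span_singleton hne]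

theorem stmt_4 (n k r : ℕ) (hn : 1 ≤ n) (hk : 1 ≤ k)
    (hr : r = ⌈(n : ℚ) / (k : ℚ)⌉₊) (hr2 : 2 ≤ r)
    (P : Fin r → Matrix (Fin n) (Fin n) ℂ)
    (hproj : ∀ i, IsOrthogonalProjection (P i))
    (hrank : ∀ i, (P i).rank ≤ k)
    (hsum : ∑ i, P i = 1)
    (V₀ : Submodule ℂ (Matrix (Fin n) (Fin n) ℂ))
    (hV₀ : IsOperatorSystem V₀)
    (hlt : V₀ < Submodule.span ℂ (Set.range P)) :
    HasQuantumAnticlique V₀ (k + 1) := by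
  classical
  have hn' : n ≤ ∑ i, (P i).rank := by simpa using card_le_sum_rank P hsum
  have hpair := fun i j (hij : i ≠ j) =>
    lt_add_of_le_sum hk hr hr2 (fun i => (P i).rank) hrank hn' hij
  have horth : ∀ i j, i ≠ j → P i * P j = 0 := fun i j hij =>
    mul_eq_zero_of_sum_eq_one P hproj hsum hij
  let L := Fintype.linearCombination ℂ P
  have hL : ∀ w, L w = ∑ i, w i • P i := fun w => Fintype.linearCombination_apply ℂ P w
  obtain ⟨c, ⟨i₀, hi₀⟩, hc2, hcW⟩ := exists_normalized_real_annihilator (V₀.comap L)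
    (fun h => hlt.not_ge (by
      rw [← Fintype.range_linearCombination ℂ P]
      rintro _ ⟨w, rfl⟩
      have : w ∈ V₀.comap L := h ▸ Submodule.mem_top
      exact this))
    (by
      rw [Submodule.mem_comap, hL]
      simpa [hsum] using hV₀.1)
    (fun w hw => by
      rw [Submodule.mem_comap, hL] at hw ⊢
      have := hV₀.2 _ hw
      rw [conjTranspose_sum] at this
      simpa [conjTranspose_smul, (hproj _).2] using this)
  obtain ⟨i₁, hi₁, hmin⟩ := Finset.exists_min_image (Finset.univ.filter fun i => 0 < c i)
    (fun i => (P i).rank) ⟨i₀, by simp [hi₀]⟩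
  simp only [Finset.mem_filter, Finset.mem_univ, true_and] at hi₁ hmin
  obtain ⟨S, -, hS⟩ := Finset.exists_subset_card_eq
    (show (P i₁).rank ≤ (Finset.univ : Finset (Fin (k + 1))).card by
      simpa using (hrank i₁).trans k.le_succ)
  let D : Fin r → Finset (Fin (k + 1)) := fun i =>
    if 0 < c i then S else if c i < 0 then Sᶜ else ∅
  have hD : ∀ i, (D i).card ≤ (P i).rank := fun i => by
    simp only [D]
    split_ifs with h h'
    · exact hS ▸ hmin i h
    · have := hpair i₁ i (by rintro rfl; exact h hi₁)
      rw [Finset.card_compl, hS, Fintype.card_fin]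
      omega
    · simp
  choose U hU hPU using fun i => exists_partial_isometry (P i) (hproj i).1 (D i) (hD i)
  obtain ⟨X, hPX⟩ : ∃ X : Matrix (Fin n) (Fin (k + 1)) ℂ,
      ∀ i, P i * X = ((√|c i| : ℝ) : ℂ) • U i := by
    refine ⟨∑ i, ((√|c i| : ℝ) : ℂ) • U i, fun i => ?_⟩
    simp only [Matrix.mul_sum, Matrix.mul_smul]
    rw [Finset.sum_eq_single i, hPU]
    · intro j _ hj
      rw [← hPU j, ← Matrix.mul_assoc, horth i j hj.symm, Matrix.zero_mul, smul_zero]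
    · simp
  have hXPX : ∀ i, Xᴴ * P i * X =
      ((|c i| : ℝ) : ℂ) • diagonal (fun b => if b ∈ D i then (1 : ℂ) else 0) := fun i => by
    calc Xᴴ * P i * X = (P i * X)ᴴ * (P i * X) := by
          rw [conjTranspose_mul, (hproj i).2, Matrix.mul_assoc, Matrix.mul_assoc,
            ← Matrix.mul_assoc (P i), (hproj i).1]
      _ = _ := by
          rw [hPX, conjTranspose_smul, Matrix.smul_mul, Matrix.mul_smul, hU, smul_smul]
          congr 1
          rw [Complex.star_def, Complex.conj_ofReal, ← Complex.ofReal_mul,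
            Real.mul_self_sqrt (abs_nonneg _)]
  have hXLX : ∀ w, L w ∈ V₀ → Xᴴ * L w * X = ((∑ i, ((|c i| : ℝ) : ℂ) * w i) / 2) • 1 := by
    intro w hw
    have hann := hcW w hw
    rw [hL, Matrix.mul_sum, Matrix.sum_mul]
    simp only [Matrix.mul_smul, Matrix.smul_mul, hXPX]
    ext s t
    rw [Matrix.sum_apply]
    simp only [Matrix.smul_apply, diagonal_apply, Matrix.one_apply, smul_eq_mul]
    by_cases hst : s = t
    swap
    · simp [hst]
    simp only [hst, if_true, mul_one]
    by_cases ht : t ∈ S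
    · have h : ∑ i, ((|c i| : ℝ) : ℂ) * w i = ∑ i, (((|c i| : ℝ) : ℂ) * w i + c i * w i) := by
        rw [Finset.sum_add_distrib, hann, add_zero]
      rw [h, Finset.sum_div]
      refine Finset.sum_congr rfl fun i _ => ?_
      rcases lt_trichotomy (c i) 0 with h | h | h
      · simp [D, h, h.not_gt, ht, abs_of_neg]
      · simp [h]
      · simp [D, h, ht, abs_of_pos]; ring
    · have h : ∑ i, ((|c i| : ℝ) : ℂ) * w i = ∑ i, (((|c i| : ℝ) : ℂ) * w i - c i * w i) := by
        rw [Finset.sum_sub_distrib, hann, sub_zero]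
      rw [h, Finset.sum_div]
      refine Finset.sum_congr rfl fun i _ => ?_
      rcases lt_trichotomy (c i) 0 with h | h | h
      · simp [D, h, h.not_gt, ht, abs_of_neg]; ring
      · simp [h]
      · simp [D, h, ht, abs_of_pos]
  refine hasQuantumAnticlique_of_isometry (by omega) hV₀.1 X ?_ fun A hA => ?_
  · have hL1 : L 1 = 1 := by rw [hL]; simpa using hsum
    have h := hXLX 1 (hL1 ▸ hV₀.1)
    rw [hL1, Matrix.mul_one] at h
    rw [h]
    simp only [Pi.one_apply, mul_one]
    rw [← Complex.ofReal_sum, hc2]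
    simp
  · have hA' := hlt.le hA
    rw [← Fintype.range_linearCombination ℂ P] at hA'
    obtain ⟨w, rfl⟩ := hA'
    exact ⟨_, hXLX w hA⟩
end

section
/- Let 𝒱 ⊆ M_n(ℂ) be an operator system with dim(𝒱) = d in which every matrix is diagonal, and let k ≥ 1. If (k−1)d + 1 ≤ n, then 𝒱 has a quantum k-anticlique. -/
open Matrix

/-- If `p` is at least as short as every point of the segment from `p` to `q`, then
`‖p‖ ^ 2 ≤ ⟪p, q⟫`. -/
theorem norm_sq_le_inner_of_forall_norm_le {E : Type*} [NormedAddCommGroup E]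
    [InnerProductSpace ℝ E] {p q : E}
    (h : ∀ t : ℝ, 0 ≤ t → t ≤ 1 → ‖p‖ ≤ ‖p + t • (q - p)‖) :
    ‖p‖ ^ 2 ≤ inner ℝ p q := by
  by_contra! hlt
  have hexp : ∀ t : ℝ, ‖p + t • (q - p)‖ ^ 2 =
      ‖p‖ ^ 2 + 2 * t * (inner ℝ p q - ‖p‖ ^ 2) + t ^ 2 * ‖q - p‖ ^ 2 := by
    intro t
    rw [norm_add_sq_real, real_inner_smul_right, inner_sub_right, real_inner_self_eq_norm_sq,
      norm_smul, mul_pow, Real.norm_eq_abs, sq_abs]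
    ring
  set δ := ‖p‖ ^ 2 - inner ℝ p q with hδ
  have hδ0 : 0 < δ := by linarith
  set s := ‖q - p‖ ^ 2 with hs
  have hs0 : 0 ≤ s := by positivity
  have hden : 0 < δ + s := by linarith
  have h1 := h (δ / (δ + s)) (by positivity) ((div_le_one hden).2 (by linarith))
  have h2 := pow_le_pow_left₀ (norm_nonneg p) h1 2
  rw [hexp] at h2
  have h3 : δ / (δ + s) * (δ / (δ + s) * s) ≤ δ / (δ + s) * δ := by
    refine mul_le_mul_of_nonneg_left ?_ (by positivity)
    rw [div_mul_eq_mul_div, div_le_iff₀ hden]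
    nlinarith
  have h4 : 0 < δ / (δ + s) * δ := by positivity
  nlinarith

/-- Weights on the simplex can be moved along an affine dependence until one of them vanishes. -/
theorem exists_mem_stdSimplex_eq_zero_of_affine_dependence {E ι : Type*} [AddCommGroup E]
    [Module ℝ E] [Fintype ι] {y : ι → E} {w c : ι → ℝ} (hw : w ∈ stdSimplex ℝ ι)
    (hc : ∑ i, c i = 0) (hcy : ∑ i, c i • y i = 0) (hc0 : c ≠ 0) :
    ∃ v ∈ stdSimplex ℝ ι, ∑ i, v i • y i = ∑ i, w i • y i ∧ ∃ i, v i = 0 := by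
  classical
  obtain ⟨i₀, hi₀⟩ : ∃ i, 0 < c i := by
    by_contra! hneg
    refine hc0 (funext fun i => ?_)
    exact (Finset.sum_eq_zero_iff_of_nonpos fun i _ => hneg i).1 hc i (Finset.mem_univ i)
  obtain ⟨i, hi, hmin⟩ := Finset.exists_min_image (Finset.univ.filter fun i => 0 < c i)
    (fun i => w i / c i) ⟨i₀, by simpa using hi₀⟩
  have hci : 0 < c i := by simpa using hi
  have ht : 0 ≤ w i / c i := div_nonneg (hw.1 i) hci.le
  refine ⟨fun l => w l - w i / c i * c l, ⟨fun l => ?_, ?_⟩, ?_, i, ?_⟩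
  · rcases lt_or_ge 0 (c l) with hl | hl
    · have := hmin l (by simpa using hl)
      rw [le_div_iff₀ hl] at this
      linarith
    · have := mul_nonpos_of_nonneg_of_nonpos ht hl
      have := hw.1 l
      linarith
  · rw [Finset.sum_sub_distrib, ← Finset.mul_sum, hc, hw.2]
    simp
  · simp only [sub_smul, mul_smul, Finset.sum_sub_distrib, ← Finset.smul_sum, hcy, smul_zero,
      sub_zero]
  · field_simp
    simp

/-- **Colourful Carathéodory theorem**: if `0` lies in the convex hull of each of more than
`finrank ℝ E` finite colour classes, then it is a convex combination of one point per class. -/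
theorem exists_colorful_convex_combination_eq_zero {E ι κ : Type*} [NormedAddCommGroup E]
    [InnerProductSpace ℝ E] [FiniteDimensional ℝ E] [Fintype ι] [Finite κ]
    (y : ι → κ → E) (hcard : Module.finrank ℝ E < Fintype.card ι)
    (hy : ∀ i, (0 : E) ∈ convexHull ℝ (Set.range (y i))) :
    ∃ f : ι → κ, ∃ w ∈ stdSimplex ℝ ι, ∑ i, w i • y i (f i) = 0 := by
  classical
  have : Nonempty ι := Fintype.card_pos_iff.1 (by omega)
  have hκ : Nonempty κ := by
    have h := convexHull_nonempty_iff.1 ⟨_, hy (Classical.arbitrary ι)⟩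
    exact Set.range_nonempty_iff_nonempty.1 h
  have hsel : ∀ i (p : E), ∃ c, inner ℝ p (y i c) ≤ 0 := by
    intro i p
    by_contra! hpos
    have hsub : convexHull ℝ (Set.range (y i)) ⊆ {x | 0 < inner ℝ p x} :=
      convexHull_min (by rintro _ ⟨c, rfl⟩; exact hpos c)
        (convex_halfSpace_gt (innerₗ E p).isLinear 0)
    simpa using hsub (hy i)
  have hne : (stdSimplex ℝ ι).Nonempty :=
    ⟨_, single_mem_stdSimplex ℝ (Classical.arbitrary ι)⟩
  have hmin : ∀ f : ι → κ, ∃ w ∈ stdSimplex ℝ ι, ∀ v ∈ stdSimplex ℝ ι,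
      ‖∑ i, w i • y i (f i)‖ ≤ ‖∑ i, v i • y i (f i)‖ := fun f => by
    obtain ⟨w, hw, hwm⟩ := (isCompact_stdSimplex ℝ ι).exists_isMinOn hne
      (f := fun w : ι → ℝ => ‖∑ i, w i • y i (f i)‖) (by fun_prop)
    exact ⟨w, hw, fun v hv => hwm hv⟩
  choose W hW hWmin using hmin
  obtain ⟨f, hf⟩ := Finite.exists_min fun f : ι → κ => ‖∑ i, W f i • y i (f i)‖
  refine ⟨f, W f, hW f, ?_⟩
  set p := ∑ i, W f i • y i (f i) with hp
  have hpmin : ∀ g : ι → κ, ∀ v ∈ stdSimplex ℝ ι, ‖p‖ ≤ ‖∑ i, v i • y i (g i)‖ :=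
    fun g v hv => (hf g).trans (hWmin g v hv)
  by_contra hp0
  have hpp : 0 < ‖p‖ ^ 2 := by positivity
  have hstep : ∀ g : ι → κ, ∀ v ∈ stdSimplex ℝ ι, ∑ i, v i • y i (g i) = p →
      ∀ i, ‖p‖ ^ 2 ≤ inner ℝ p (y i (g i)) := by
    intro g v hv hvp i
    refine norm_sq_le_inner_of_forall_norm_le fun t ht0 ht1 => ?_
    have hmem := convex_stdSimplex ℝ ι hv (single_mem_stdSimplex ℝ i)
      (sub_nonneg.2 ht1) ht0 (by ring)
    convert hpmin g _ hmem using 2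
    simp only [Pi.add_apply, Pi.smul_apply, smul_eq_mul, add_smul, mul_smul,
      Finset.sum_add_distrib, ← Finset.smul_sum, hvp]
    rw [Finset.sum_eq_single i (by intro b _ hb; simp [hb]) (by simp)]
    simp only [Pi.single_eq_same, one_smul]
    module
  obtain ⟨v, hv, hvp, i, hvi⟩ : ∃ v ∈ stdSimplex ℝ ι, ∑ i, v i • y i (f i) = p ∧
      ∃ i, v i = 0 := by
    by_cases hz : ∃ i, W f i = 0
    · exact ⟨W f, hW f, rfl, hz⟩
    push Not at hz
    have hge := hstep f (W f) (hW f) rfl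
    have hsum : ∑ i, W f i * (inner ℝ p (y i (f i)) - ‖p‖ ^ 2) = 0 := by
      have h1 : ∑ i, W f i * inner ℝ p (y i (f i)) = ‖p‖ ^ 2 := by
        rw [← real_inner_self_eq_norm_sq]
        nth_rw 3 [hp]
        simp only [inner_sum, real_inner_smul_right]
      simp only [mul_sub, Finset.sum_sub_distrib, h1, ← Finset.sum_mul, (hW f).2, one_mul,
        sub_self]
    have heq : ∀ i, inner ℝ p (y i (f i)) = ‖p‖ ^ 2 := by
      intro i
      have h1 := (Finset.sum_eq_zero_iff_of_nonneg fun i _ =>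
        mul_nonneg ((hW f).1 i) (sub_nonneg.2 (hge i))).1 hsum i (Finset.mem_univ i)
      have h2 := (mul_eq_zero.1 h1).resolve_left (hz i)
      linarith
    have hdep : ¬ LinearIndependent ℝ fun i => y i (f i) := fun hli =>
      hcard.not_ge hli.fintype_card_le_finrank
    obtain ⟨c, hcy, hc0⟩ := Fintype.not_linearIndependent_iff.1 hdep
    refine exists_mem_stdSimplex_eq_zero_of_affine_dependence (hW f) (c := c) ?_ hcy ?_
    · have h1 : inner ℝ p (∑ i, c i • y i (f i)) = 0 := by rw [hcy, inner_zero_right]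
      simp only [inner_sum, real_inner_smul_right, heq, ← Finset.sum_mul] at h1
      exact (mul_eq_zero.1 h1).resolve_right hpp.ne'
    · rintro rfl
      simp at hc0
  obtain ⟨c, hc⟩ := hsel i p
  have hg := hstep (Function.update f i c) v hv ?_ i
  · simp only [Function.update_self] at hg
    linarith
  · rw [← hvp]
    refine Finset.sum_congr rfl fun l _ => ?_
    by_cases hl : l = i
    · subst hl
      simp [hvi]
    · rw [Function.update_of_ne hl]

/-- **Tverberg's theorem**, in homogeneous form: more than `m * card β` vectors of `β → ℝ` can be
split into `m + 1` classes whose weighted sums agree, for suitable weights. -/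
theorem exists_coloring_weighted_sum_eq {ι β : Type*} [Fintype ι] [Fintype β] (m : ℕ)
    (x : ι → β → ℝ) (hcard : m * Fintype.card β < Fintype.card ι) :
    ∃ f : ι → Fin (m + 1), ∃ w ∈ stdSimplex ℝ ι, ∀ b c,
      ∑ i, (if f i = c then w i * x i b else 0) =
        ∑ i, (if f i = Fin.last m then w i * x i b else 0) := by
  let y : ι → Fin (m + 1) → EuclideanSpace ℝ (β × Fin m) := fun i c =>
    WithLp.toLp 2 fun z => x i z.1 *
      ((if c = z.2.castSucc then 1 else 0) - (if c = Fin.last m then 1 else 0))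
  have hy : ∀ i, (0 : EuclideanSpace ℝ (β × Fin m)) ∈ convexHull ℝ (Set.range (y i)) := by
    intro i
    have hsum : ∑ c, y i c = 0 := by
      ext z
      simp [y, ← Finset.mul_sum]
    have h := Finset.centerMass_mem_convexHull (R := ℝ) (s := Set.range (y i)) Finset.univ
      (w := fun _ => 1) (z := y i) (by simp)
      (by simp; positivity) (by simp)
    simpa [Finset.centerMass, hsum] using h
  obtain ⟨f, w, hw, hfw⟩ := exists_colorful_convex_combination_eq_zero y
    (by simpa [mul_comm] using hcard) hy
  refine ⟨f, w, hw, fun b c => ?_⟩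
  induction c using Fin.lastCases with
  | last => rfl
  | cast a =>
    have h := congrArg (fun v : EuclideanSpace ℝ (β × Fin m) => v (b, a)) hfw
    simp only [y, WithLp.ofLp_sum, WithLp.ofLp_smul, Finset.sum_apply, Pi.smul_apply, smul_eq_mul,
      PiLp.zero_apply, mul_sub, mul_ite, mul_one, mul_zero, Finset.sum_sub_distrib] at h
    linarith

/-- An operator system is spanned by a linearly independent set of Hermitian matrices. -/
theorem IsOperatorSystem.exists_linearIndepOn_isHermitian {ι : Type*} [Fintype ι] [DecidableEq ι]
    {V : Submodule ℂ (Matrix ι ι ℂ)} (hV : IsOperatorSystem V) :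
    ∃ b : Set (Matrix ι ι ℂ), (∀ A ∈ b, A.IsHermitian) ∧
      LinearIndepOn ℂ id b ∧ Submodule.span ℂ b = V := by
  obtain ⟨b, hbs, hspan, hli⟩ := exists_linearIndependent ℂ {A | A ∈ V ∧ A.IsHermitian}
  refine ⟨b, fun A hA => (hbs hA).2, hli, hspan.trans (le_antisymm ?_ fun A hA => ?_)⟩
  · exact Submodule.span_le.2 fun A hA => hA.1
  · have h1 : A + Aᴴ ∈ Submodule.span ℂ {A | A ∈ V ∧ A.IsHermitian} :=
      Submodule.subset_span ⟨V.add_mem hA (hV.2 A hA), by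
        simp [Matrix.IsHermitian, add_comm]⟩
    have h2 : Complex.I • (A - Aᴴ) ∈ Submodule.span ℂ {A | A ∈ V ∧ A.IsHermitian} :=
      Submodule.subset_span ⟨V.smul_mem _ (V.sub_mem hA (hV.2 A hA)), by
        simp [Matrix.IsHermitian, conjTranspose_smul, smul_sub, neg_add_eq_sub]⟩
    have h3 : A = (1 / 2 : ℂ) • (A + Aᴴ) + (-Complex.I / 2) • (Complex.I • (A - Aᴴ)) := by
      rw [smul_smul, show -Complex.I / 2 * Complex.I = 1 / 2 by
        rw [div_mul_eq_mul_div, neg_mul, Complex.I_mul_I]; norm_num]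
      module
    rw [h3]
    exact Submodule.add_mem _ (Submodule.smul_mem _ _ h1) (Submodule.smul_mem _ _ h2)

open scoped ComplexOrder in
/-- An isometry compressing every element of `V` to a scalar yields a quantum anticlique. -/
theorem IsOperatorSystem.hasQuantumAnticlique_of_isometry {ι : Type*} [Fintype ι] [DecidableEq ι]
    {V : Submodule ℂ (Matrix ι ι ℂ)} (hV : IsOperatorSystem V) {k : ℕ} (hk : 1 ≤ k)
    (M : Matrix ι (Fin k) ℂ) (hM : Mᴴ * M = 1)
    (hA : ∀ A ∈ V, ∃ a : ℂ, Mᴴ * A * M = a • (1 : Matrix (Fin k) (Fin k) ℂ)) :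
    HasQuantumAnticlique V k := by
  have hPP : M * Mᴴ * (M * Mᴴ) = M * Mᴴ := by
    rw [Matrix.mul_assoc, ← Matrix.mul_assoc Mᴴ, hM, Matrix.one_mul]
  have hrank : (M * Mᴴ).rank = k := by
    rw [Matrix.rank_self_mul_conjTranspose, ← Matrix.rank_conjTranspose_mul_self, hM,
      Matrix.rank_one, Fintype.card_fin]
  refine ⟨M * Mᴴ, ⟨hPP, by simp⟩, hrank, ?_⟩
  have hne : M * Mᴴ ≠ 0 := fun h => by
    rw [h, Matrix.rank_zero] at hrank
    omega
  suffices h : compress (M * Mᴴ) V = Submodule.span ℂ {M * Mᴴ} by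
    rw [h, finrank_span_singleton hne]
  refine le_antisymm ?_ ?_
  · rintro _ ⟨A, hAV, rfl⟩
    obtain ⟨a, ha⟩ := hA A hAV
    refine Submodule.mem_span_singleton.2 ⟨a, ?_⟩
    have h : M * Mᴴ * (A * (M * Mᴴ)) = M * (Mᴴ * A * M) * Mᴴ := by
      simp only [Matrix.mul_assoc]
    simp [h, ha]
  · rw [Submodule.span_singleton_le_iff_mem]
    exact ⟨1, hV.1, by simp [hPP]⟩

theorem stmt_7 (n k d : ℕ) (hk : 1 ≤ k)
    (V : Submodule ℂ (Matrix (Fin n) (Fin n) ℂ)) (hV : IsOperatorSystem V)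
    (hd : Module.finrank ℂ V = d)
    (hdiag : ∀ A ∈ V, A.IsDiag)
    (hcond : (k - 1) * d + 1 ≤ n) :
    HasQuantumAnticlique V k := by
  obtain ⟨m, rfl⟩ : ∃ m, k = m + 1 := ⟨k - 1, by omega⟩
  obtain ⟨b, hherm, hli, hspan⟩ := hV.exists_linearIndepOn_isHermitian
  have hbfin : b.Finite := hli.linearIndependent.setFinite
  have : Fintype b := hbfin.fintype
  have hcardb : Fintype.card b = d := by
    rw [← hd, ← hspan, finrank_span_set_eq_card hli, Set.toFinset_card]
  obtain ⟨f, w, hw, hfw⟩ := exists_coloring_weighted_sum_eq m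
    (fun (i : Fin n) (B : b) => (B.1 i i).re) (by simpa [hcardb] using hcond)
  have hV_eq : ∀ A ∈ V, ∀ c, ∑ i, (if f i = c then (w i : ℂ) * A i i else 0) =
      ∑ i, (if f i = Fin.last m then (w i : ℂ) * A i i else 0) := by
    intro A hA c
    rw [← hspan] at hA
    induction hA using Submodule.span_induction with
    | mem B hB =>
      have hre : ∀ i, B i i = ((B i i).re : ℂ) := fun i =>
        (Complex.conj_eq_iff_re.1 ((hherm B hB).apply i i)).symm
      have h := congrArg (fun r : ℝ => (r : ℂ)) (hfw ⟨B, hB⟩ c)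
      push_cast at h
      simpa only [← hre, apply_ite (fun r : ℝ => (r : ℂ)), Complex.ofReal_mul,
        Complex.ofReal_zero] using h
    | zero => simp
    | add B C _ _ hB hC =>
      simp only [Matrix.add_apply, mul_add, ite_add_zero, Finset.sum_add_distrib, hB, hC]
    | smul a B _ hB =>
      have h : ∀ c, ∑ i, (if f i = c then (w i : ℂ) * (a • B) i i else 0) =
          a * ∑ i, (if f i = c then (w i : ℂ) * B i i else 0) := fun c => by
        rw [Finset.mul_sum]
        refine Finset.sum_congr rfl fun i _ => ?_
        split_ifs <;> simp [mul_left_comm]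
      rw [h, h, hB]
  have hmass : ∀ c, ((m + 1 : ℕ) : ℂ) * ∑ i, (if f i = c then (w i : ℂ) else 0) = 1 := by
    have hone := hV_eq 1 hV.1
    simp only [Matrix.one_apply_eq, mul_one] at hone
    have htot : ∑ c, ∑ i, (if f i = c then (w i : ℂ) else 0) = 1 := by
      rw [Finset.sum_comm]
      simpa using congrArg (fun r : ℝ => (r : ℂ)) hw.2
    intro c
    rw [hone c, ← htot, Finset.sum_congr rfl fun c _ => hone c]
    simp
  let M : Matrix (Fin n) (Fin (m + 1)) ℂ := Matrix.of fun i c =>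
    if f i = c then ((Real.sqrt ((m + 1 : ℕ) * w i) : ℝ) : ℂ) else 0
  have hsq : ∀ i, ((Real.sqrt ((m + 1 : ℕ) * w i) : ℝ) : ℂ) *
      ((Real.sqrt ((m + 1 : ℕ) * w i) : ℝ) : ℂ) = ((m + 1 : ℕ) : ℂ) * (w i : ℂ) := fun i => by
    rw [← Complex.ofReal_mul, Real.mul_self_sqrt (mul_nonneg (Nat.cast_nonneg _) (hw.1 i))]
    simp
  have hcomp : ∀ A : Matrix (Fin n) (Fin n) ℂ, A.IsDiag → ∀ c c', (Mᴴ * A * M) c c' =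
      if c = c' then ((m + 1 : ℕ) : ℂ) * ∑ i, (if f i = c then (w i : ℂ) * A i i else 0)
      else 0 := by
    intro A hA c c'
    rw [← hA.diagonal_diag, Matrix.mul_apply]
    simp only [Matrix.mul_diagonal, Matrix.conjTranspose_apply, Matrix.diag_apply,
      Matrix.diagonal_apply_eq, Matrix.of_apply, M]
    split_ifs with hcc
    · subst hcc
      rw [Finset.mul_sum]
      refine Finset.sum_congr rfl fun i _ => ?_
      split_ifs with hi
      · rw [Complex.star_def, Complex.conj_ofReal, mul_right_comm, hsq, mul_assoc]
      · simp
    · refine Finset.sum_eq_zero fun i _ => ?_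
      by_cases hi : f i = c
      · simp [show f i ≠ c' from fun h => hcc (hi.symm.trans h)]
      · simp [hi]
  refine hV.hasQuantumAnticlique_of_isometry hk M ?_ fun A hA =>
    ⟨((m + 1 : ℕ) : ℂ) * ∑ i, (if f i = Fin.last m then (w i : ℂ) * A i i else 0), ?_⟩
  · ext c c'
    have h := hcomp 1 Matrix.isDiag_one c c'
    simp only [Matrix.mul_one, Matrix.one_apply_eq, mul_one, hmass] at h
    rw [h, Matrix.one_apply]
  · ext c c'
    rw [hcomp A (hdiag A hA), hV_eq A hA c]
    simp [Matrix.one_apply]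
end
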